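/- Let w be an A₂ weight on ℝ^d and let σ = {σ_{I,α}} be a bounded sequence indexed by dyadic cubes I ∈ 𝒟 and α ∈ Γ_d. Then the Haar multiplier T_σ is bounded on the weighted space L²(w) with norm satisfying ‖T_σ‖_{L²(w)→L²(w)} ≤ C_d · [w]_{A₂} · ‖σ‖_∞, where C_d depends only on the dimension d. -/

import Mathlib

open MeasureTheory

noncomputable section

/-- A dyadic cube in `ℝ^d`: the cube `∏ᵢ [mᵢ 2^k, (mᵢ+1) 2^k)`. -/
structure DyadicCube (d : ℕ) where
  k : ℤ
  m : Fin d → ℤ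
deriving DecidableEq

namespace DyadicCube

/-- The underlying set of a dyadic cube. -/
def toSet {d : ℕ} (I : DyadicCube d) : Set (Fin d → ℝ) :=
  {x | ∀ i, (I.m i : ℝ) * (2 : ℝ) ^ I.k ≤ x i ∧ x i < ((I.m i : ℝ) + 1) * (2 : ℝ) ^ I.k}

/-- `J` is a dyadic child of `I`. -/
def IsChild {d : ℕ} (J I : DyadicCube d) : Prop :=
  J.k + 1 = I.k ∧ J.toSet ⊆ I.toSet

end DyadicCube

/-- The index set `Γ_d = {0,1}^d \ {(1,…,1)}`. -/
def Gamma (d : ℕ) : Type := {v : Fin d → Bool // v ≠ fun _ => true}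

instance {d : ℕ} : DecidableEq (Gamma d) := Subtype.instDecidableEq

/-- The average `⟨f⟩_E` of `f` over a set `E`. -/
def avg {d : ℕ} (E : Set (Fin d → ℝ)) (f : (Fin d → ℝ) → ℝ) : ℝ :=
  (∫ x in E, f x) / (volume E).toReal

/-- An axis-parallel cube with corner `c` and side length `r`. -/
def Cube {d : ℕ} (c : Fin d → ℝ) (r : ℝ) : Set (Fin d → ℝ) :=
  {x | ∀ i, c i ≤ x i ∧ x i < c i + r}

/-- `A` is an upper bound for the `A₂` characteristic of `w`:
`⟨w⟩_I ⟨w⁻¹⟩_I ≤ A` for every cube `I`. -/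
def IsA2Bound {d : ℕ} (w : (Fin d → ℝ) → ℝ) (A : ℝ) : Prop :=
  ∀ (c : Fin d → ℝ) (r : ℝ), 0 < r →
    avg (Cube c r) w * avg (Cube c r) (fun x => (w x)⁻¹) ≤ A

/-- A weight: a positive, measurable, locally integrable function (with locally
integrable reciprocal). -/
def IsWeight {d : ℕ} (w : (Fin d → ℝ) → ℝ) : Prop :=
  (∀ x, 0 < w x) ∧ Measurable w ∧ LocallyIntegrable w volume ∧
    LocallyIntegrable (fun x => (w x)⁻¹) volume

/-- The `L¹`-normalized indicator `h¹_E = 1_E / |E|`. -/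
def h1 {d : ℕ} (E : Set (Fin d → ℝ)) : (Fin d → ℝ) → ℝ :=
  fun x => ((volume E).toReal)⁻¹ * E.indicator (fun _ => (1 : ℝ)) x

/-- Wilson's system of pairs of sets `(E¹_{α,I}, E²_{α,I})` indexed by dyadic cubes
`I` and `α ∈ Γ_d`. -/
structure WilsonSystem (d : ℕ) where
  E1 : DyadicCube d → Gamma d → Set (Fin d → ℝ)
  E2 : DyadicCube d → Gamma d → Set (Fin d → ℝ)
  childUnion1 : ∀ I α, ∃ S : Finset (DyadicCube d), S.Nonempty ∧
    (∀ J ∈ S, J.IsChild I) ∧ E1 I α = ⋃ J ∈ S, J.toSet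
  childUnion2 : ∀ I α, ∃ S : Finset (DyadicCube d), S.Nonempty ∧
    (∀ J ∈ S, J.IsChild I) ∧ E2 I α = ⋃ J ∈ S, J.toSet
  measEq : ∀ I α, volume (E1 I α) = volume (E2 I α)
  disj : ∀ I α, Disjoint (E1 I α) (E2 I α)
  nestedOrDisjoint : ∀ I α J β, (I, α) ≠ (J, β) →
    (E1 I α ∪ E2 I α) ⊆ E1 J β ∨ (E1 I α ∪ E2 I α) ⊆ E2 J β ∨
    (E1 J β ∪ E2 J β) ⊆ E1 I α ∨ (E1 J β ∪ E2 J β) ⊆ E2 I α ∨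
    Disjoint (E1 I α ∪ E2 I α) (E1 J β ∪ E2 J β)

namespace WilsonSystem

variable {d : ℕ}

/-- `E_{α,I} = E¹_{α,I} ∪ E²_{α,I}`. -/
def E (W : WilsonSystem d) (I : DyadicCube d) (α : Gamma d) : Set (Fin d → ℝ) :=
  W.E1 I α ∪ W.E2 I α

/-- The Wilson Haar function `h_I^α = |E_{α,I}|^{-1/2} (1_{E²_{α,I}} - 1_{E¹_{α,I}})`. -/
def haar (W : WilsonSystem d) (I : DyadicCube d) (α : Gamma d) : (Fin d → ℝ) → ℝ :=
  fun x => (Real.sqrt (volume (W.E I α)).toReal)⁻¹ *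
    ((W.E2 I α).indicator (fun _ => (1 : ℝ)) x - (W.E1 I α).indicator (fun _ => (1 : ℝ)) x)

/-- The Haar coefficient `f̂(I,α) = ⟨f, h_I^α⟩_{L²}`. -/
def hcoef (W : WilsonSystem d) (f : (Fin d → ℝ) → ℝ) (I : DyadicCube d) (α : Gamma d) : ℝ :=
  ∫ x, f x * W.haar I α x

/-- The weighted Wilson Haar function `h_I^{w,α}`. -/
def haarW (W : WilsonSystem d) (w : (Fin d → ℝ) → ℝ) (I : DyadicCube d) (α : Gamma d) :
    (Fin d → ℝ) → ℝ :=
  fun x => (Real.sqrt (∫ y in W.E I α, w y))⁻¹ *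
    (Real.sqrt ((∫ y in W.E1 I α, w y) / (∫ y in W.E2 I α, w y)) *
        (W.E2 I α).indicator (fun _ => (1 : ℝ)) x -
      Real.sqrt ((∫ y in W.E2 I α, w y) / (∫ y in W.E1 I α, w y)) *
        (W.E1 I α).indicator (fun _ => (1 : ℝ)) x)

/-- The Haar multiplier `T_σ f = ∑_{I,α} σ_{I,α} f̂(I,α) h_I^α`. -/
def Tmult (W : WilsonSystem d) (σ : DyadicCube d → Gamma d → ℝ) (f : (Fin d → ℝ) → ℝ) :
    (Fin d → ℝ) → ℝ :=
  fun x => ∑' p : DyadicCube d × Gamma d, σ p.1 p.2 * W.hcoef f p.1 p.2 * W.haar p.1 p.2 x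

/-- The paraproduct `P_a^{(0,0)} f = ∑_{I,α} a_{I,α} f̂(I,α) h_I^α`. -/
def P00 (W : WilsonSystem d) (a : DyadicCube d → Gamma d → ℝ) (f : (Fin d → ℝ) → ℝ) :
    (Fin d → ℝ) → ℝ :=
  fun x => ∑' p : DyadicCube d × Gamma d, a p.1 p.2 * W.hcoef f p.1 p.2 * W.haar p.1 p.2 x

/-- The paraproduct `P_a^{(0,1)} f = ∑_{I,α} a_{I,α} ⟨f⟩_{E_{α,I}} h_I^α`. -/
def P01 (W : WilsonSystem d) (a : DyadicCube d → Gamma d → ℝ) (f : (Fin d → ℝ) → ℝ) :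
    (Fin d → ℝ) → ℝ :=
  fun x => ∑' p : DyadicCube d × Gamma d, a p.1 p.2 * avg (W.E p.1 p.2) f * W.haar p.1 p.2 x

/-- The paraproduct `P_a^{(1,0)} f = ∑_{I,α} a_{I,α} f̂(I,α) h¹_{E_{α,I}}`. -/
def P10 (W : WilsonSystem d) (a : DyadicCube d → Gamma d → ℝ) (f : (Fin d → ℝ) → ℝ) :
    (Fin d → ℝ) → ℝ :=
  fun x => ∑' p : DyadicCube d × Gamma d, a p.1 p.2 * W.hcoef f p.1 p.2 * h1 (W.E p.1 p.2) x

/-- The dyadic square function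
`S f(x) = (∑_{I,α} |f̂(I,α)|² 1_I(x)/|I|)^{1/2}`. -/
def sqFn (W : WilsonSystem d) (f : (Fin d → ℝ) → ℝ) : (Fin d → ℝ) → ℝ :=
  fun x => Real.sqrt (∑' p : DyadicCube d × Gamma d,
    (W.hcoef f p.1 p.2) ^ 2 * p.1.toSet.indicator (fun _ => (1 : ℝ)) x /
      (volume p.1.toSet).toReal)

/-- The canonical paraproduct of type `ε` built from the function `g`:
`ε = 0` gives `P^{(0,1)}_{ĝ}`, `ε = 1` gives `P^{(1,0)}_{ĝ}`, and `ε = 2` gives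
`P^{(0,0)}_{⟨g⟩}`. -/
def paraOf (W : WilsonSystem d) (g : (Fin d → ℝ) → ℝ) (ε : Fin 3) :
    ((Fin d → ℝ) → ℝ) → ((Fin d → ℝ) → ℝ) :=
  if ε = 0 then W.P01 (fun I α => W.hcoef g I α)
  else if ε = 1 then W.P10 (fun I α => W.hcoef g I α)
  else W.P00 (fun I α => avg (W.E I α) g)

end WilsonSystem

/-- The weighted measure `w(x) dx` on `ℝ^d`. -/
def wMeasure {d : ℕ} (w : (Fin d → ℝ) → ℝ) : Measure (Fin d → ℝ) :=
  volume.withDensity fun x => ENNReal.ofReal (w x)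

namespace HaarCore

open Classical in
/-- Stopped tree sums: `hs` at stopped nodes, `hl` at leaves, `hn` at interior nodes. -/
def R {ι β : Type} [Fintype β] (ch : ι → β → ι) (sel : ι → Prop) (hs : ℕ → ι → ℝ)
    (hl hn : ι → ℝ) : ℕ → ι → ℝ
  | 0, Q => if sel Q then hs 0 Q else hl Q
  | n + 1, Q => if sel Q then hs (n + 1) Q else hn Q + ∑ b, R ch sel hs hl hn n (ch Q b)

def T {ι β : Type} [Fintype β] (ch : ι → β → ι) (a : ι → ℝ) : ℕ → ι → ℝ
  | 0, _ => 0
  | n + 1, Q => a Q + ∑ b, T ch a n (ch Q b)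

section
variable {ι β : Type} [Fintype β] (ch : ι → β → ι) (sel : ι → Prop)

lemma R_nonneg {hs : ℕ → ι → ℝ} {hl hn : ι → ℝ} (h1 : ∀ n Q, 0 ≤ hs n Q) (h2 : ∀ Q, 0 ≤ hl Q)
    (h3 : ∀ Q, 0 ≤ hn Q) (n : ℕ) (Q : ι) : 0 ≤ R ch sel hs hl hn n Q := by
  induction n generalizing Q with
  | zero => unfold R; split_ifs; exacts [h1 _ _, h2 _]
  | succ n ih =>
    unfold R; split_ifs
    · exact h1 _ _
    · exact add_nonneg (h3 _) (Finset.sum_nonneg fun b _ => ih _)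

lemma R_mono {hs hs' : ℕ → ι → ℝ} {hl hn hl' hn' : ι → ℝ} (n : ℕ)
    (h1 : ∀ m ≤ n, ∀ Q, sel Q → hs m Q ≤ hs' m Q)
    (h2 : ∀ Q, hl Q ≤ hl' Q) (h3 : ∀ Q, hn Q ≤ hn' Q) (Q : ι) :
    R ch sel hs hl hn n Q ≤ R ch sel hs' hl' hn' n Q := by
  induction n generalizing Q with
  | zero => unfold R; split_ifs with h; exacts [h1 _ le_rfl _ h, h2 _]
  | succ n ih =>
    unfold R; split_ifs with h
    · exact h1 _ le_rfl _ h
    · exact add_le_add (h3 _) (Finset.sum_le_sum fun b _ => ih (fun m hm => h1 m (by omega)) _)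

lemma R_lin (x y : ℝ) (hs hs' : ℕ → ι → ℝ) (hl hn hl' hn' : ι → ℝ) (n : ℕ) (Q : ι) :
    R ch sel (fun n Q => x * hs n Q + y * hs' n Q) (fun Q => x * hl Q + y * hl' Q)
      (fun Q => x * hn Q + y * hn' Q) n Q =
    x * R ch sel hs hl hn n Q + y * R ch sel hs' hl' hn' n Q := by
  induction n generalizing Q with
  | zero => unfold R; split_ifs <;> rfl
  | succ n ih =>
    unfold R; split_ifs with h
    · rfl
    · simp only [ih, Finset.sum_add_distrib, ← Finset.mul_sum]; ring

lemma sqrt_two {a b c d : ℝ} (ha : 0 ≤ a) (hb : 0 ≤ b) (hc : 0 ≤ c) (hd : 0 ≤ d) :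
    √a * √b + √c * √d ≤ √(a + c) * √(b + d) := by
  rw [← Real.sqrt_mul (add_nonneg ha hc)]
  apply Real.le_sqrt_of_sq_le
  have h1 := Real.sq_sqrt ha
  have h2 := Real.sq_sqrt hb
  have h3 := Real.sq_sqrt hc
  have h4 := Real.sq_sqrt hd
  have e : (a + c) * (b + d) = (√a ^ 2 + √c ^ 2) * (√b ^ 2 + √d ^ 2) := by
    rw [h1, h2, h3, h4]
  rw [e]
  nlinarith [sq_nonneg (√a * √d - √c * √b)]

lemma R_cs {cs as bs : ℕ → ι → ℝ} {cl al bl cn an bn : ι → ℝ}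
    (a1 : ∀ n Q, 0 ≤ as n Q) (a2 : ∀ Q, 0 ≤ al Q) (a3 : ∀ Q, 0 ≤ an Q)
    (b1 : ∀ n Q, 0 ≤ bs n Q) (b2 : ∀ Q, 0 ≤ bl Q) (b3 : ∀ Q, 0 ≤ bn Q)
    (c1 : ∀ n Q, cs n Q ≤ √(as n Q) * √(bs n Q)) (c2 : ∀ Q, cl Q ≤ √(al Q) * √(bl Q))
    (c3 : ∀ Q, cn Q ≤ √(an Q) * √(bn Q)) (n : ℕ) (Q : ι) :
    R ch sel cs cl cn n Q ≤ √(R ch sel as al an n Q) * √(R ch sel bs bl bn n Q) := by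
  induction n generalizing Q with
  | zero => unfold R; split_ifs with h; exacts [c1 _ _, c2 _]
  | succ n ih =>
    unfold R; split_ifs with h
    · exact c1 _ _
    · calc _ ≤ √(an Q) * √(bn Q) + ∑ b, √(R ch sel as al an n (ch Q b)) *
              √(R ch sel bs bl bn n (ch Q b)) :=
            add_le_add (c3 _) (Finset.sum_le_sum fun b _ => ih _)
        _ ≤ √(an Q) * √(bn Q) + √(∑ b, (R ch sel as al an n (ch Q b))) *
              √(∑ b, (R ch sel bs bl bn n (ch Q b))) := by
            gcongr
            exact Real.sum_sqrt_mul_sqrt_le _ (fun b => R_nonneg ch sel a1 a2 a3 _ _)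
              (fun b => R_nonneg ch sel b1 b2 b3 _ _)
        _ ≤ _ := sqrt_two (a3 _) (b3 _)
            (Finset.sum_nonneg fun b _ => R_nonneg ch sel a1 a2 a3 _ _)
            (Finset.sum_nonneg fun b _ => R_nonneg ch sel b1 b2 b3 _ _)

lemma R_cs_sq {cs as bs : ℕ → ι → ℝ} {cl al bl cn an bn : ι → ℝ}
    (a1 : ∀ n Q, 0 ≤ as n Q) (a2 : ∀ Q, 0 ≤ al Q) (a3 : ∀ Q, 0 ≤ an Q)
    (b1 : ∀ n Q, 0 ≤ bs n Q) (b2 : ∀ Q, 0 ≤ bl Q) (b3 : ∀ Q, 0 ≤ bn Q)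
    (d1 : ∀ n Q, 0 ≤ cs n Q) (d2 : ∀ Q, 0 ≤ cl Q) (d3 : ∀ Q, 0 ≤ cn Q)
    (c1 : ∀ n Q, cs n Q ^ 2 ≤ as n Q * bs n Q) (c2 : ∀ Q, cl Q ^ 2 ≤ al Q * bl Q)
    (c3 : ∀ Q, cn Q ^ 2 ≤ an Q * bn Q) (n : ℕ) (Q : ι) :
    R ch sel cs cl cn n Q ^ 2 ≤ R ch sel as al an n Q * R ch sel bs bl bn n Q := by
  have hA := R_nonneg ch sel a1 a2 a3 n Q
  have hB := R_nonneg ch sel b1 b2 b3 n Q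
  have hC := R_nonneg ch sel d1 d2 d3 n Q
  have key := R_cs ch sel (cs := cs) (cl := cl) (cn := cn) a1 a2 a3 b1 b2 b3
    (fun n Q => by rw [← Real.sqrt_mul (a1 n Q)]; exact Real.le_sqrt_of_sq_le (c1 n Q))
    (fun Q => by rw [← Real.sqrt_mul (a2 Q)]; exact Real.le_sqrt_of_sq_le (c2 Q))
    (fun Q => by rw [← Real.sqrt_mul (a3 Q)]; exact Real.le_sqrt_of_sq_le (c3 Q)) n Q
  rw [← Real.sqrt_mul hA] at key
  calc _ ≤ √(R ch sel as al an n Q * R ch sel bs bl bn n Q) ^ 2 := by gcongr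
    _ = _ := Real.sq_sqrt (by positivity)

lemma R_additive {H : ι → ℝ} (hH : ∀ Q, H Q = ∑ b, H (ch Q b)) (n : ℕ) (Q : ι) :
    H Q = R ch sel (fun _ => H) 0 0 n Q + R ch sel 0 H 0 n Q := by
  induction n generalizing Q with
  | zero => unfold R; split_ifs <;> simp
  | succ n ih =>
    unfold R; split_ifs with h
    · simp
    · simp only [Pi.zero_apply, zero_add]
      rw [← Finset.sum_add_distrib, hH Q]
      exact Finset.sum_congr rfl fun b _ => ih _

lemma T_decomp (a : ι → ℝ) (n : ℕ) (Q : ι) :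
    T ch a n Q = R ch sel 0 0 a n Q + R ch sel (T ch a) 0 0 n Q := by
  induction n generalizing Q with
  | zero => unfold R T; split_ifs <;> simp
  | succ n ih =>
    unfold R; split_ifs with h
    · simp
    · simp only [Pi.zero_apply, zero_add]
      rw [add_assoc, ← Finset.sum_add_distrib]
      simp only [T]
      congr 1
      exact Finset.sum_congr rfl fun b _ => ih _

/-- The energy of the unstopped part. -/
lemma energy {vol U u Δ : ι → ℝ} {c0 l : ℝ}
    (hvol : ∀ Q, 0 < vol Q) (hch : ∀ Q b, vol Q = c0 * vol (ch Q b))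
    (hva : ∀ Q, vol Q = ∑ b, vol (ch Q b))
    (hU : ∀ Q, 0 ≤ U Q) (hUa : ∀ Q, U Q = ∑ b, U (ch Q b)) (hu : ∀ Q, |u Q| ≤ U Q)
    (hΔ : ∀ Q, Δ Q = ∑ b, u (ch Q b) ^ 2 / vol (ch Q b) - u Q ^ 2 / vol Q)
    (hsel : ∀ Q, ¬ sel Q → U Q ≤ l * vol Q) (n : ℕ) (Q : ι) (hQ : U Q ≤ c0 * l * vol Q) :
    R ch sel 0 0 Δ n Q ≤ (c0 * l) ^ 2 * vol Q - u Q ^ 2 / vol Q := by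
  have key : ∀ Q, U Q ≤ c0 * l * vol Q → 0 ≤ (c0 * l) ^ 2 * vol Q - u Q ^ 2 / vol Q := by
    intro Q hQ
    rw [sub_nonneg, div_le_iff₀ (hvol Q)]
    have : u Q ^ 2 ≤ (c0 * l * vol Q) ^ 2 := sq_le_sq' (by linarith [abs_le.1 (hu Q)])
      (by linarith [abs_le.1 (hu Q)])
    linarith
  induction n generalizing Q with
  | zero => unfold R; split_ifs <;> exact key Q hQ
  | succ n ih =>
    unfold R; split_ifs with h
    · exact key Q hQ
    · have h1 : ∀ b, R ch sel 0 0 Δ n (ch Q b) ≤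
          (c0 * l) ^ 2 * vol (ch Q b) - u (ch Q b) ^ 2 / vol (ch Q b) := by
        intro b
        apply ih
        calc U (ch Q b) ≤ ∑ b, U (ch Q b) :=
              Finset.single_le_sum (f := fun b => U (ch Q b)) (fun b _ => hU _) (Finset.mem_univ b)
          _ = U Q := (hUa Q).symm
          _ ≤ l * vol Q := hsel Q h
          _ = _ := by rw [hch Q b]; ring
      calc _ ≤ Δ Q + ∑ b, ((c0 * l) ^ 2 * vol (ch Q b) - u (ch Q b) ^ 2 / vol (ch Q b)) := by
            gcongr with b; exact h1 b
        _ = _ := by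
            rw [hΔ, Finset.sum_sub_distrib, ← Finset.mul_sum, ← hva]; ring

lemma scalar {U U1 U2 s s1 s2 Z X2 : ℝ} (hU : U = U1 + U2) (hs : s = s1 + s2) (h0 : 0 < s)
    (h1 : 0 ≤ s1) (h2 : 0 ≤ s2) (hZ : 0 ≤ Z) (hX : 0 ≤ X2)
    (h3 : U1 ^ 2 ≤ Z * s1) (h4 : U2 ^ 2 ≤ X2 * s2) :
    (U / s) ^ 2 * s2 + 2 * (U ^ 2 / s) ≤ 2 * Z + 4 * X2 := by
  have gen : ∀ {p q r t : ℝ}, 0 ≤ q → 0 ≤ r → p ^ 2 ≤ q * r → 2 * t * p - t ^ 2 * r ≤ q := by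
    intro p q r t hq hr h
    rcases hr.eq_or_lt with hr | hr
    · subst hr
      have : p = 0 := by nlinarith
      subst this; simpa using hq
    · have : r * (2 * t * p - t ^ 2 * r) ≤ r * q := by nlinarith [sq_nonneg (p - t * r)]
      exact le_of_mul_le_mul_left this hr
  have e1 := gen (t := U / s) hZ h1 h3
  have e2 := gen (t := U / s / 2) hX h2 h4
  have e3 : U = U / s * s := by field_simp
  set t := U / s with ht
  have e4 : U ^ 2 / s = t ^ 2 * s := by rw [ht]; field_simp
  rw [e4]
  have : t * (U1 + U2) = t ^ 2 * (s1 + s2) := by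
    rw [← hU, ← hs]; linear_combination t * e3
  rw [hs]
  nlinarith

lemma amgm {x y S W v : ℝ} (hx : 0 ≤ x) (hy : 0 ≤ y) (hS : 0 ≤ S) (hW : 0 ≤ W)
    (h : v ^ 2 ≤ S * W) : 2 * (x * y * v) ≤ x ^ 2 * S + y ^ 2 * W := by
  have h1 : (2 * (x * y * v)) ^ 2 ≤ (x ^ 2 * S + y ^ 2 * W) ^ 2 := by
    have h2 : x ^ 2 * y ^ 2 * v ^ 2 ≤ x ^ 2 * y ^ 2 * (S * W) := by gcongr
    nlinarith [sq_nonneg (x ^ 2 * S - y ^ 2 * W)]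
  exact (abs_le_of_sq_le_sq' h1 (by positivity)).2

/-- Carleson-type step. -/
lemma carleson {s X U : ι → ℝ} (hs : ∀ Q, 0 < s Q) (hX : ∀ Q, 0 ≤ X Q) (hU : ∀ Q, 0 ≤ U Q)
    (hsa : ∀ Q, s Q = ∑ b, s (ch Q b)) (hXa : ∀ Q, X Q = ∑ b, X (ch Q b))
    (hUa : ∀ Q, U Q = ∑ b, U (ch Q b)) (hUX : ∀ Q, U Q ^ 2 ≤ X Q * s Q) (n : ℕ) (P : ι) :
    (U P / s P) ^ 2 * R ch sel 0 s 0 n P +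
      R ch sel (fun _ Q => 4 * X Q - 2 * (U Q ^ 2 / s Q)) 0 0 n P ≤
    4 * X P - 2 * (U P ^ 2 / s P) := by
  have z1 : ∀ (n : ℕ) (Q : ι), (0 : ℝ) ≤ (0 : ℕ → ι → ℝ) n Q := fun _ _ => le_rfl
  have z2 : ∀ (Q : ι), (0 : ℝ) ≤ (0 : ι → ℝ) Q := fun _ => le_rfl
  have hlin := R_lin ch sel 4 (-2) (fun _ => X) (fun _ Q => U Q ^ 2 / s Q) 0 0 0 0 n P
  have e : R ch sel (fun _ Q => 4 * X Q - 2 * (U Q ^ 2 / s Q)) 0 0 n P =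
      4 * R ch sel (fun _ => X) 0 0 n P - 2 * R ch sel (fun _ Q => U Q ^ 2 / s Q) 0 0 n P := by
    rw [sub_eq_add_neg, ← neg_mul, ← hlin]
    congr 1
    · ext m Q; ring
    · ext Q; simp
    · ext Q; simp
  have hsn : ∀ Q, 0 ≤ s Q := fun Q => (hs Q).le
  have hZ : ∀ Q, 0 ≤ U Q ^ 2 / s Q := fun Q => div_nonneg (sq_nonneg _) (hsn Q)
  have := scalar (R_additive ch sel hUa n P) (R_additive ch sel hsa n P) (hs P)
    (R_nonneg ch sel (fun _ => hsn) z2 z2 n P) (R_nonneg ch sel z1 hsn z2 n P)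
    (R_nonneg ch sel (hs := fun _ Q => U Q ^ 2 / s Q) (fun _ => hZ) z2 z2 n P)
    (R_nonneg ch sel z1 hX z2 n P)
    (R_cs_sq ch sel (fun _ => hZ) z2 z2 (fun _ => hsn) z2 z2 (fun _ => hU) z2 z2
      (fun _ Q => by rw [div_mul_cancel₀ _ (hs Q).ne']) (by simp) (by simp) n P)
    (R_cs_sq ch sel z1 hX z2 z1 hsn z2 z1 hU z2 (by simp) hUX (by simp) n P)
  have h3 := R_additive ch sel hXa n P
  rw [e]
  linarith

set_option maxHeartbeats 1000000 in
theorem main (vol s w X Y U V u v Δu Δv a : ι → ℝ) (c0 M A : ℝ)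
    (hc0 : 1 ≤ c0) (hM : 0 ≤ M) (hA : 0 ≤ A)
    (hvol : ∀ Q, 0 < vol Q) (hs : ∀ Q, 0 < s Q) (hw : ∀ Q, 0 < w Q)
    (hX : ∀ Q, 0 ≤ X Q) (hY : ∀ Q, 0 ≤ Y Q) (hU : ∀ Q, 0 ≤ U Q) (hV : ∀ Q, 0 ≤ V Q)
    (hch : ∀ Q b, vol Q = c0 * vol (ch Q b))
    (hva : ∀ Q, vol Q = ∑ b, vol (ch Q b))
    (hsa : ∀ Q, s Q = ∑ b, s (ch Q b)) (hwa : ∀ Q, w Q = ∑ b, w (ch Q b))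
    (hXa : ∀ Q, X Q = ∑ b, X (ch Q b)) (hYa : ∀ Q, Y Q = ∑ b, Y (ch Q b))
    (hUa : ∀ Q, U Q = ∑ b, U (ch Q b)) (hVa : ∀ Q, V Q = ∑ b, V (ch Q b))
    (hu : ∀ Q, |u Q| ≤ U Q) (hv : ∀ Q, |v Q| ≤ V Q)
    (hUX : ∀ Q, U Q ^ 2 ≤ X Q * s Q) (hVY : ∀ Q, V Q ^ 2 ≤ Y Q * w Q)
    (hsw : ∀ Q, vol Q ^ 2 ≤ s Q * w Q) (hA2 : ∀ Q, s Q * w Q ≤ A * vol Q ^ 2)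
    (hΔu : ∀ Q, Δu Q = ∑ b, u (ch Q b) ^ 2 / vol (ch Q b) - u Q ^ 2 / vol Q)
    (hΔv : ∀ Q, Δv Q = ∑ b, v (ch Q b) ^ 2 / vol (ch Q b) - v Q ^ 2 / vol Q)
    (hΔu0 : ∀ Q, 0 ≤ Δu Q) (hΔv0 : ∀ Q, 0 ≤ Δv Q)
    (ha : ∀ Q, a Q ≤ M * (√(Δu Q) * √(Δv Q))) (n : ℕ) (P : ι) :
    T ch a n P ≤ (16 * c0 ^ 2 * M * A) *
      ((4 * X P - 2 * (U P ^ 2 / s P)) + (4 * Y P - 2 * (V P ^ 2 / w P))) := by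
  induction n using Nat.strong_induction_on generalizing P with
  | _ n ih =>
  set D := 16 * c0 ^ 2 * M * A with hD
  have hD0 : 0 ≤ D := by positivity
  set K : ι → ℝ := fun P => D *
      ((4 * X P - 2 * (U P ^ 2 / s P)) + (4 * Y P - 2 * (V P ^ 2 / w P))) with hK
  have z1 : ∀ (n : ℕ) (Q : ι), (0 : ℝ) ≤ (0 : ℕ → ι → ℝ) n Q := fun _ _ => le_rfl
  have z2 : ∀ (Q : ι), (0 : ℝ) ≤ (0 : ι → ℝ) Q := fun _ => le_rfl
  set l := 4 * U P / vol P with hl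
  set m := 4 * V P / vol P with hm
  have hl0 : 0 ≤ l := div_nonneg (by linarith [hU P]) (hvol P).le
  have hm0 : 0 ≤ m := div_nonneg (by linarith [hV P]) (hvol P).le
  let sel : ι → Prop := fun Q => l * vol Q < U Q ∨ m * vol Q < V Q
  have hlP : l * vol P = 4 * U P := by rw [hl]; field_simp [(hvol P).ne']
  have hmP : m * vol P = 4 * V P := by rw [hm]; field_simp [(hvol P).ne']
  have hns : ¬ sel P := by
    simp only [sel, not_or, not_lt, hlP, hmP]
    exact ⟨by linarith [hU P], by linarith [hV P]⟩
  -- replace T by K at stopped cubes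
  have step1 : R ch sel (T ch a) 0 0 n P ≤ R ch sel (fun _ => K) 0 0 n P := by
    cases n with
    | zero => unfold R; simp [hns]
    | succ n =>
      unfold R
      simp only [hns, if_false, Pi.zero_apply, zero_add]
      exact Finset.sum_le_sum fun b _ => R_mono ch sel n
        (fun m hm Q _ => ih m (by omega) Q) (fun _ => le_rfl) (fun _ => le_rfl) _
  have step2 : R ch sel (fun _ => K) 0 0 n P =
      D * (R ch sel (fun _ Q => 4 * X Q - 2 * (U Q ^ 2 / s Q)) 0 0 n P +
       R ch sel (fun _ Q => 4 * Y Q - 2 * (V Q ^ 2 / w Q)) 0 0 n P) := by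
    rw [mul_add, ← R_lin ch sel D D]
    congr 1
    · ext m Q; simp only [hK]; ring
    · ext Q; simp
    · ext Q; simp
  have c1 := carleson ch sel hs hX hU hsa hXa hUa hUX n P
  have c2 := carleson ch sel hw hY hV hwa hYa hVa hVY n P
  -- energy
  have eu := energy ch sel hvol hch hva hU hUa hu hΔu
    (fun Q hQ => by simp only [sel, not_or, not_lt] at hQ; exact hQ.1) n P (by
      rw [mul_assoc, hlP]; nlinarith [hU P])
  have ev := energy ch sel hvol hch hva hV hVa hv hΔv
    (fun Q hQ => by simp only [sel, not_or, not_lt] at hQ; exact hQ.2) n P (by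
      rw [mul_assoc, hmP]; nlinarith [hV P])
  have good : R ch sel 0 0 a n P ≤ 16 * c0 ^ 2 * M * (U P * V P / vol P) := by
    have r1 : R ch sel 0 0 a n P ≤ M * R ch sel 0 0 (fun Q => √(Δu Q) * √(Δv Q)) n P := by
      have := R_lin ch sel M 0 0 0 0 (fun Q => √(Δu Q) * √(Δv Q)) 0 0 n P
      rw [zero_mul, add_zero] at this
      rw [← this]
      apply R_mono
      · intros; simp
      · intros; simp
      · intro Q; simpa using ha Q
    have r2 := R_cs ch sel (cs := 0) (cl := 0) (cn := fun Q => √(Δu Q) * √(Δv Q))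
      z1 z2 hΔu0 z1 z2 hΔv0 (by simp) (by simp) (fun Q => le_rfl) n P
    have r3 : √(R ch sel 0 0 Δu n P) ≤ √((c0 * l) ^ 2 * vol P) := by
      apply Real.sqrt_le_sqrt
      have : 0 ≤ u P ^ 2 / vol P := div_nonneg (sq_nonneg _) (hvol P).le
      linarith
    have r4 : √(R ch sel 0 0 Δv n P) ≤ √((c0 * m) ^ 2 * vol P) := by
      apply Real.sqrt_le_sqrt
      have : 0 ≤ v P ^ 2 / vol P := div_nonneg (sq_nonneg _) (hvol P).le
      linarith
    have r5 : √((c0 * l) ^ 2 * vol P) * √((c0 * m) ^ 2 * vol P) =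
        16 * c0 ^ 2 * (U P * V P / vol P) := by
      rw [Real.sqrt_mul (sq_nonneg _), Real.sqrt_mul (sq_nonneg _), Real.sqrt_sq (by positivity),
        Real.sqrt_sq (by positivity)]
      have : √(vol P) * √(vol P) = vol P := Real.mul_self_sqrt (hvol P).le
      calc _ = c0 ^ 2 * l * m * (√(vol P) * √(vol P)) := by ring
        _ = _ := by rw [this, hl, hm]; field_simp [(hvol P).ne']; ring
    calc _ ≤ M * R ch sel 0 0 (fun Q => √(Δu Q) * √(Δv Q)) n P := r1
      _ ≤ M * (√((c0 * l) ^ 2 * vol P) * √((c0 * m) ^ 2 * vol P)) := by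
          gcongr
          exact r2.trans (by gcongr)
      _ = _ := by rw [r5]; ring
  have sE := R_nonneg ch sel z1 (fun Q => (hs Q).le) z2 n P
  have wE := R_nonneg ch sel z1 (fun Q => (hw Q).le) z2 n P
  have vE := R_nonneg ch sel z1 (fun Q => (hvol Q).le) z2 n P
  have sparse : U P * V P / vol P ≤ A * ((U P / s P) ^ 2 * R ch sel 0 s 0 n P +
      (V P / w P) ^ 2 * R ch sel 0 w 0 n P) := by
    rcases (hU P).eq_or_lt with h0 | hUp
    · rw [← h0]; simp; positivity
    rcases (hV P).eq_or_lt with h0 | hVp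
    · rw [← h0]; simp; positivity
    have hvp := hvol P
    have hsp := hs P
    have hwp := hw P
    -- measure of stopped part
    have lpos : 0 < l := by positivity
    have mpos : 0 < m := by positivity
    have q1 : R ch sel (fun _ => vol) 0 0 n P ≤ l⁻¹ * R ch sel (fun _ => U) 0 0 n P +
        m⁻¹ * R ch sel (fun _ => V) 0 0 n P := by
      rw [← R_lin]
      apply R_mono
      · intro _ _ Q hQ
        have := hU Q
        have := hV Q
        rcases hQ with hQ | hQ
        · have : vol Q ≤ l⁻¹ * U Q := by
            rw [inv_mul_eq_div, le_div_iff₀ lpos]; linarith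
          have : 0 ≤ m⁻¹ * V Q := by positivity
          linarith
        · have : vol Q ≤ m⁻¹ * V Q := by
            rw [inv_mul_eq_div, le_div_iff₀ mpos]; linarith
          have : 0 ≤ l⁻¹ * U Q := by positivity
          linarith
      · intro Q; simp
      · intro Q; simp
    have q2 : l⁻¹ * R ch sel (fun _ => U) 0 0 n P ≤ vol P / 4 := by
      have h := R_additive ch sel hUa n P
      have h' := R_nonneg ch sel z1 hU z2 n P
      rw [inv_mul_eq_div, div_le_iff₀ lpos]; linarith
    have q3 : m⁻¹ * R ch sel (fun _ => V) 0 0 n P ≤ vol P / 4 := by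
      have h := R_additive ch sel hVa n P
      have h' := R_nonneg ch sel z1 hV z2 n P
      rw [inv_mul_eq_div, div_le_iff₀ mpos]; linarith
    have q4 := R_additive ch sel hva n P
    have q5 : vol P ≤ 2 * R ch sel 0 vol 0 n P := by linarith
    have q6 := R_cs_sq ch sel z1 (fun Q => (hs Q).le) z2 z1 (fun Q => (hw Q).le) z2 z1
      (fun Q => (hvol Q).le) z2 (by simp) hsw (by simp) n P
    set SE := R ch sel 0 s 0 n P
    set WE := R ch sel 0 w 0 n P
    set VE := R ch sel 0 vol 0 n P
    set x := U P / s P with hx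
    set y := V P / w P with hy
    have hx0 : 0 < x := by positivity
    have hy0 : 0 < y := by positivity
    have e1 : U P * V P / vol P = x * y * (s P * w P / vol P) := by
      rw [hx, hy]; field_simp
    have e2 : s P * w P / vol P ≤ A * vol P := by
      rw [div_le_iff₀ hvp]; linarith [hA2 P]
    have e3 : 2 * (x * y * VE) ≤ x ^ 2 * SE + y ^ 2 * WE := by
      exact amgm hx0.le hy0.le sE wE q6
    calc U P * V P / vol P = x * y * (s P * w P / vol P) := e1
      _ ≤ x * y * (A * vol P) := by gcongr
      _ ≤ x * y * (A * (2 * VE)) := by gcongr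
      _ = A * (2 * (x * y * VE)) := by ring
      _ ≤ _ := by gcongr
  have goodD : R ch sel 0 0 a n P ≤ D * ((U P / s P) ^ 2 * R ch sel 0 s 0 n P +
      (V P / w P) ^ 2 * R ch sel 0 w 0 n P) := by
    calc _ ≤ _ := good
      _ ≤ 16 * c0 ^ 2 * M * (A * ((U P / s P) ^ 2 * R ch sel 0 s 0 n P +
      (V P / w P) ^ 2 * R ch sel 0 w 0 n P)) := by gcongr
      _ = _ := by rw [hD]; ring
  rw [T_decomp ch sel a n P]
  have fin := mul_le_mul_of_nonneg_left (add_le_add c1 c2) hD0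
  rw [step2] at step1
  linarith
end
end HaarCore

lemma HaarCore.amgm' {p q r : ℝ} (hq : 0 ≤ q) (hr : 0 ≤ r) (_hp : 0 ≤ p) (h : p ^ 2 ≤ q * r) (t : ℝ) :
    0 ≤ t * t * q + -2 * t * p + r := by
  rcases hq.eq_or_lt with h0 | h0
  · subst h0
    have : p = 0 := by nlinarith
    subst this; simpa using hr
  · have : 0 ≤ q * (t * t * q + -2 * t * p + r) := by nlinarith [sq_nonneg (q * t - p)]
    exact nonneg_of_mul_nonneg_right this h0
namespace DyadicCube
variable {d : ℕ}

/-- The dyadic child of `Q` with binary label `b`. -/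
def child (Q : DyadicCube d) (b : Fin d → Bool) : DyadicCube d :=
  ⟨Q.k - 1, fun i => 2 * Q.m i + (if b i then 1 else 0)⟩

/-- The volume as a real number. -/
def vol (Q : DyadicCube d) : ℝ := ((2 : ℝ) ^ Q.k) ^ d

lemma vol_pos (Q : DyadicCube d) : 0 < Q.vol := by unfold vol; positivity

lemma two_zpow_sub (k : ℤ) : (2 : ℝ) ^ k = 2 * (2 : ℝ) ^ (k - 1) := by
  rw [zpow_sub_one₀ (by norm_num)]; ring

lemma vol_child (Q : DyadicCube d) (b : Fin d → Bool) : Q.vol = 2 ^ d * (Q.child b).vol := by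
  unfold vol child
  simp only
  rw [two_zpow_sub Q.k, mul_pow]

lemma toSet_eq (Q : DyadicCube d) : Q.toSet = Set.pi Set.univ fun i =>
    Set.Ico ((Q.m i : ℝ) * (2 : ℝ) ^ Q.k) (((Q.m i : ℝ) + 1) * (2 : ℝ) ^ Q.k) := by
  ext x; simp [toSet]

lemma measurableSet_toSet (Q : DyadicCube d) : MeasurableSet Q.toSet := by
  rw [toSet_eq]; exact MeasurableSet.univ_pi fun i => measurableSet_Ico

lemma volume_toSet (Q : DyadicCube d) : volume Q.toSet = ENNReal.ofReal Q.vol := by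
  rw [toSet_eq, Real.volume_pi_Ico]
  have : ∀ i, ((Q.m i : ℝ) + 1) * (2 : ℝ) ^ Q.k - (Q.m i : ℝ) * (2 : ℝ) ^ Q.k = 2 ^ Q.k := by
    intro i; ring
  simp only [this, Finset.prod_const, Finset.card_univ, Fintype.card_fin, vol]
  rw [ENNReal.ofReal_pow (by positivity)]

lemma volume_toReal (Q : DyadicCube d) : (volume Q.toSet).toReal = Q.vol := by
  rw [volume_toSet, ENNReal.toReal_ofReal Q.vol_pos.le]

lemma toSet_eq_cube (Q : DyadicCube d) :
    Q.toSet = Cube (fun i => (Q.m i : ℝ) * (2 : ℝ) ^ Q.k) ((2 : ℝ) ^ Q.k) := by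
  ext x; simp [toSet, Cube, add_mul]

lemma mem_iff_floor (Q : DyadicCube d) (x : Fin d → ℝ) :
    x ∈ Q.toSet ↔ ∀ i, ⌊x i / (2 : ℝ) ^ Q.k⌋ = Q.m i := by
  have h : (0 : ℝ) < 2 ^ Q.k := by positivity
  simp only [toSet, Set.mem_ofPred_eq, Int.floor_eq_iff, le_div_iff₀ h, div_lt_iff₀ h]

lemma mem_child_iff (Q : DyadicCube d) (b : Fin d → Bool) (x : Fin d → ℝ) :
    x ∈ (Q.child b).toSet ↔
      ∀ i, ⌊x i / (2 : ℝ) ^ (Q.k - 1)⌋ = 2 * Q.m i + (if b i then 1 else 0) := by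
  rw [mem_iff_floor]; rfl

lemma floor_half (y : ℝ) (k : ℤ) : ⌊y / (2 : ℝ) ^ k⌋ = ⌊y / (2 : ℝ) ^ (k - 1)⌋ / 2 := by
  have : y / (2 : ℝ) ^ k = y / (2 : ℝ) ^ (k - 1) / ((2 : ℕ) : ℝ) := by
    rw [two_zpow_sub k, div_div, mul_comm]; norm_num
  rw [this, Int.floor_div_natCast]; norm_num

lemma toSet_eq_iUnion (Q : DyadicCube d) : Q.toSet = ⋃ b, (Q.child b).toSet := by
  ext x
  simp only [Set.mem_iUnion, mem_child_iff]
  simp only [mem_iff_floor, fun i => floor_half (x i) Q.k]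
  constructor
  · intro h
    refine ⟨fun i => decide (⌊x i / (2 : ℝ) ^ (Q.k - 1)⌋ % 2 = 1), fun i => ?_⟩
    have := h i
    simp only [decide_eq_true_eq]
    split_ifs <;> omega
  · rintro ⟨b, hb⟩ i
    rw [hb i]
    split_ifs <;> omega

lemma disjoint_of_k_eq {I J : DyadicCube d} (hk : I.k = J.k) (h : I ≠ J) :
    Disjoint I.toSet J.toSet := by
  rw [Set.disjoint_left]
  intro x hI hJ
  rw [mem_iff_floor] at hI hJ
  apply h
  cases I; cases J
  simp only at hk hI hJ
  subst hk
  congr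
  ext i
  rw [← hI i, ← hJ i]

lemma child_injective (Q : DyadicCube d) : Function.Injective Q.child := by
  intro b c h
  have h' : (Q.child b).m = (Q.child c).m := by rw [h]
  ext i
  have := congrFun h' i
  simp only [child] at this
  cases hb : b i <;> cases hc : c i <;> simp_all

lemma child_disjoint (Q : DyadicCube d) :
    Pairwise (Function.onFun Disjoint fun b => (Q.child b).toSet) := by
  intro b c h
  exact disjoint_of_k_eq rfl fun e => h (Q.child_injective e)

/-- The parent cube. -/
def par (Q : DyadicCube d) : DyadicCube d := ⟨Q.k + 1, fun i => Q.m i / 2⟩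

lemma exists_child_par (Q : DyadicCube d) : ∃ b, Q.par.child b = Q := by
  refine ⟨fun i => decide (Q.m i % 2 = 1), ?_⟩
  cases Q with
  | mk k m =>
    simp only [par, child, decide_eq_true_eq]
    congr 1
    · ring
    · ext i; split_ifs <;> omega

lemma isChild_exists {J I : DyadicCube d} (h : J.IsChild I) : ∃ b, J = I.child b := by
  obtain ⟨hk, hs⟩ := h
  have hpos : (0 : ℝ) < 2 ^ J.k := by positivity
  have hx : (fun i => (J.m i : ℝ) * (2 : ℝ) ^ J.k) ∈ J.toSet := by
    rw [mem_iff_floor]; intro i; rw [mul_div_cancel_right₀ _ hpos.ne']; simp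
  have hx' := hs hx
  rw [mem_iff_floor] at hx'
  have : J.par = I := by
    cases I with
    | mk k m =>
      simp only at hk hx'
      simp only [par]
      congr 1
      ext i
      rw [← hx' i, floor_half, ← hk, add_sub_cancel_right, mul_div_cancel_right₀ _ hpos.ne']
      simp
  obtain ⟨b, hb⟩ := J.exists_child_par
  exact ⟨b, by rw [← this, hb]⟩

lemma toSet_subset_closed (Q : DyadicCube d) : ∃ K : Set (Fin d → ℝ), IsCompact K ∧ Q.toSet ⊆ K :=
  ⟨Set.Icc (fun i => (Q.m i : ℝ) * (2 : ℝ) ^ Q.k) (fun i => ((Q.m i : ℝ) + 1) * (2 : ℝ) ^ Q.k),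
    isCompact_Icc, fun _ hx => ⟨fun i => (hx i).1, fun i => (hx i).2.le⟩⟩

lemma integrableOn_of_loc {w : (Fin d → ℝ) → ℝ} (hw : LocallyIntegrable w volume)
    (Q : DyadicCube d) : IntegrableOn w Q.toSet := by
  obtain ⟨K, hK, hs⟩ := Q.toSet_subset_closed
  exact (hw.integrableOn_isCompact hK).mono_set hs

lemma setIntegral_additive {f : (Fin d → ℝ) → ℝ} (Q : DyadicCube d) (hf : IntegrableOn f Q.toSet) :
    ∫ x in Q.toSet, f x = ∑ b, ∫ x in (Q.child b).toSet, f x := by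
  conv_lhs => rw [toSet_eq_iUnion]
  exact integral_iUnion_fintype (fun b => measurableSet_toSet _) Q.child_disjoint
    (fun b => hf.mono_set (by rw [toSet_eq_iUnion Q]; exact Set.subset_iUnion (fun b => (Q.child b).toSet) b))

lemma child_subset (Q : DyadicCube d) (b) : (Q.child b).toSet ⊆ Q.toSet := by
  rw [toSet_eq_iUnion Q]; exact Set.subset_iUnion (fun b => (Q.child b).toSet) b

lemma vol_additive (Q : DyadicCube d) : Q.vol = ∑ b, (Q.child b).vol := by
  have : ∀ b, (Q.child b).vol = Q.vol / 2 ^ d := by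
    intro b; rw [Q.vol_child b]; field_simp
  simp [this]
  field_simp

instance : Countable (DyadicCube d) :=
  Function.Injective.countable (f := fun Q : DyadicCube d => (Q.k, Q.m)) (by
    rintro ⟨k, m⟩ ⟨k', m'⟩ h; simp at h; simp [h])

lemma sum_biUnion_le_aux {κ ι : Type*} [DecidableEq ι] (G : κ → Finset ι) (a : ι → ℝ)
    (ha : ∀ i, 0 ≤ a i) (s : Finset κ) :
    ∑ i ∈ s.biUnion G, a i ≤ ∑ b ∈ s, ∑ i ∈ G b, a i := by
  classical
  induction s using Finset.induction_on with
  | empty => simp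
  | insert b s hb ih =>
    rw [Finset.biUnion_insert, Finset.sum_insert hb]
    have := Finset.sum_union_inter (s₁ := G b) (s₂ := s.biUnion G) (f := a)
    have h2 : 0 ≤ ∑ i ∈ G b ∩ s.biUnion G, a i := Finset.sum_nonneg fun i _ => ha i
    linarith

/-- Iterated ancestors control finite sums. -/
lemma sum_le_T (a : DyadicCube d → ℝ) (ha : ∀ Q, 0 ≤ a Q) (n : ℕ) (Q : DyadicCube d)
    (F : Finset (DyadicCube d)) (hF : ∀ I ∈ F, ∃ j < n, par^[j] I = Q) :
    ∑ I ∈ F, a I ≤ HaarCore.T child a n Q := by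
  classical
  induction n generalizing Q F with
  | zero =>
    have : F = ∅ := Finset.eq_empty_of_forall_notMem fun I hI => by
      obtain ⟨j, hj, _⟩ := hF I hI; omega
    simp [this, HaarCore.T]
  | succ n ih =>
    let G : (Fin d → Bool) → Finset (DyadicCube d) := fun b =>
      F.filter fun I => ∃ j < n, par^[j] I = Q.child b
    have hsub : F ⊆ insert Q (Finset.univ.biUnion G) := by
      intro I hI
      obtain ⟨j, hj, h⟩ := hF I hI
      rw [Finset.mem_insert]
      cases j with
      | zero => left; simpa using h
      | succ j =>
        right
        rw [Function.iterate_succ_apply'] at h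
        obtain ⟨b, hb⟩ := exists_child_par (par^[j] I)
        rw [h] at hb
        simp only [Finset.mem_biUnion, Finset.mem_univ, true_and, G, Finset.mem_filter]
        exact ⟨b, hI, j, by omega, hb.symm⟩
    calc ∑ I ∈ F, a I ≤ ∑ I ∈ insert Q (Finset.univ.biUnion G), a I :=
          Finset.sum_le_sum_of_subset_of_nonneg hsub fun I _ _ => ha I
      _ ≤ a Q + ∑ I ∈ Finset.univ.biUnion G, a I := by
          by_cases h : Q ∈ Finset.univ.biUnion G
          · rw [Finset.insert_eq_of_mem h]; linarith [ha Q]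
          · rw [Finset.sum_insert h]
      _ ≤ a Q + ∑ b, ∑ I ∈ G b, a I := by
          gcongr
          exact sum_biUnion_le_aux G a ha _
      _ ≤ a Q + ∑ b, HaarCore.T child a n (Q.child b) := by
          gcongr with b
          exact ih _ _ fun I hI => (Finset.mem_filter.1 hI).2

lemma par_iterate_k (j : ℕ) (I : DyadicCube d) : (par^[j] I).k = I.k + j := by
  induction j with
  | zero => simp
  | succ j ih => rw [Function.iterate_succ_apply']; simp only [par, ih]; push_cast; ring

/-- A finite sum over cubes is bounded by tree sums over disjoint top cubes. -/
lemma exists_tops (F : Finset (DyadicCube d)) : ∃ (n : ℕ) (S : Finset (DyadicCube d)),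
    (∀ I ∈ S, ∀ J ∈ S, I ≠ J → Disjoint I.toSet J.toSet) ∧
    ∀ a : DyadicCube d → ℝ, (∀ Q, 0 ≤ a Q) → ∑ I ∈ F, a I ≤ ∑ Q ∈ S, HaarCore.T child a n Q := by
  classical
  obtain ⟨K, hK⟩ : ∃ K : ℤ, ∀ I ∈ F, I.k ≤ K := by
    obtain ⟨K, hK⟩ := (F.image fun I => I.k).bddAbove
    exact ⟨K, fun I hI => hK (by simpa using ⟨I, hI, rfl⟩)⟩
  obtain ⟨L, hL⟩ : ∃ L : ℤ, ∀ I ∈ F, L ≤ I.k := by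
    obtain ⟨K, hK⟩ := (F.image fun I => I.k).bddBelow
    exact ⟨K, fun I hI => hK (by simpa using ⟨I, hI, rfl⟩)⟩
  let anc : DyadicCube d → DyadicCube d := fun I => par^[(K - I.k).toNat] I
  refine ⟨(K - L).toNat + 1, F.image anc, ?_, ?_⟩
  · have hk : ∀ I ∈ F.image anc, I.k = K := by
      intro I hI
      obtain ⟨J, hJ, rfl⟩ := Finset.mem_image.1 hI
      have := hK J hJ
      simp only [anc, par_iterate_k]; omega
    intro I hI J hJ h
    exact disjoint_of_k_eq ((hk I hI).trans (hk J hJ).symm) h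
  · intro a ha
    rw [← Finset.sum_fiberwise_of_maps_to (s := F) (t := F.image anc) (g := anc)
      (fun I hI => Finset.mem_image_of_mem _ hI)]
    gcongr with Q hQ
    apply sum_le_T a ha
    intro I hI
    rw [Finset.mem_filter] at hI
    have := hK I hI.1
    have := hL I hI.1
    exact ⟨(K - I.k).toNat, by omega, hI.2⟩

end DyadicCube
namespace WilsonSystem
variable {d : ℕ}

instance gammaFintype : Fintype (Gamma d) :=
  inferInstanceAs (Fintype {v : Fin d → Bool // v ≠ fun _ => true})

lemma union_children {I : DyadicCube d} {E : Set (Fin d → ℝ)}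
    (h : ∃ S : Finset (DyadicCube d), S.Nonempty ∧ (∀ J ∈ S, J.IsChild I) ∧ E = ⋃ J ∈ S, J.toSet) :
    ∃ B : Finset (Fin d → Bool), B.Nonempty ∧ E = ⋃ b ∈ B, (I.child b).toSet := by
  classical
  obtain ⟨S, ⟨J0, hJ0⟩, hS, rfl⟩ := h
  refine ⟨Finset.univ.filter fun b => I.child b ∈ S, ?_, ?_⟩
  · obtain ⟨b, hb⟩ := DyadicCube.isChild_exists (hS J0 hJ0)
    exact ⟨b, by simp [← hb, hJ0]⟩
  · ext x
    simp only [Set.mem_iUnion, Finset.mem_filter, Finset.mem_univ, true_and, exists_prop]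
    constructor
    · rintro ⟨J, hJ, hx⟩
      obtain ⟨b, hb⟩ := DyadicCube.isChild_exists (hS J hJ)
      exact ⟨b, hb ▸ hJ, hb ▸ hx⟩
    · rintro ⟨b, hb, hx⟩
      exact ⟨_, hb, hx⟩

lemma union_meas {I : DyadicCube d} (B : Finset (Fin d → Bool)) :
    MeasurableSet (⋃ b ∈ B, (I.child b).toSet) :=
  Finset.measurableSet_biUnion _ fun b _ => DyadicCube.measurableSet_toSet _

lemma union_subset {I : DyadicCube d} (B : Finset (Fin d → Bool)) :
    (⋃ b ∈ B, (I.child b).toSet) ⊆ I.toSet := by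
  simp only [Set.iUnion_subset_iff]
  exact fun b _ => I.child_subset b

lemma union_integral {I : DyadicCube d} (B : Finset (Fin d → Bool)) {f : (Fin d → ℝ) → ℝ}
    (hf : IntegrableOn f I.toSet) :
    ∫ x in ⋃ b ∈ B, (I.child b).toSet, f x = ∑ b ∈ B, ∫ x in (I.child b).toSet, f x :=
  integral_biUnion_finset B (fun b _ => DyadicCube.measurableSet_toSet _)
    (fun b _ c _ h => I.child_disjoint h) (fun b _ => hf.mono_set (I.child_subset b))

lemma union_volume {I : DyadicCube d} (B : Finset (Fin d → Bool)) :
    (volume (⋃ b ∈ B, (I.child b).toSet)).toReal = B.card * (I.vol / 2 ^ d) := by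
  rw [measure_biUnion_finset (fun b _ c _ h => I.child_disjoint h)
    (fun b _ => DyadicCube.measurableSet_toSet _), ENNReal.toReal_sum]
  · have : ∀ b, (I.child b).vol = I.vol / 2 ^ d := by
      intro b; rw [I.vol_child b]; field_simp
    simp [DyadicCube.volume_toReal, this]
  · intro b _; rw [DyadicCube.volume_toSet]; exact ENNReal.ofReal_ne_top

variable (W : WilsonSystem d)

lemma E1_meas (I α) : MeasurableSet (W.E1 I α) := by
  obtain ⟨B, _, h⟩ := union_children (W.childUnion1 I α); rw [h]; exact union_meas B
lemma E2_meas (I α) : MeasurableSet (W.E2 I α) := by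
  obtain ⟨B, _, h⟩ := union_children (W.childUnion2 I α); rw [h]; exact union_meas B
lemma E_meas (I α) : MeasurableSet (W.E I α) := (W.E1_meas I α).union (W.E2_meas I α)
lemma E1_sub (I α) : W.E1 I α ⊆ I.toSet := by
  obtain ⟨B, _, h⟩ := union_children (W.childUnion1 I α); rw [h]; exact union_subset B
lemma E2_sub (I α) : W.E2 I α ⊆ I.toSet := by
  obtain ⟨B, _, h⟩ := union_children (W.childUnion2 I α); rw [h]; exact union_subset B
lemma E_sub (I α) : W.E I α ⊆ I.toSet := Set.union_subset (W.E1_sub I α) (W.E2_sub I α)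

lemma volE_ge (I α) : I.vol / 2 ^ d ≤ (volume (W.E I α)).toReal := by
  obtain ⟨B, hB, h⟩ := union_children (W.childUnion1 I α)
  have h1 : (volume (W.E1 I α)).toReal ≤ (volume (W.E I α)).toReal := by
    apply ENNReal.toReal_mono
    · refine ((measure_mono (W.E_sub I α)).trans_lt ?_).ne
      rw [DyadicCube.volume_toSet]; exact ENNReal.ofReal_lt_top
    · exact measure_mono Set.subset_union_left
  refine le_trans ?_ h1
  rw [h, union_volume]
  have : (1 : ℝ) ≤ B.card := by exact_mod_cast hB.card_pos
  have := I.vol_pos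
  have h3 : 0 < I.vol / 2 ^ d := by positivity
  nlinarith

lemma volE_pos (I α) : 0 < (volume (W.E I α)).toReal :=
  lt_of_lt_of_le (by have := I.vol_pos; positivity) (W.volE_ge I α)

lemma hcoef_eq {f : (Fin d → ℝ) → ℝ} (I α) (hf : IntegrableOn f I.toSet) :
    W.hcoef f I α = (√(volume (W.E I α)).toReal)⁻¹ *
      ((∫ x in W.E2 I α, f x) - ∫ x in W.E1 I α, f x) := by
  unfold hcoef haar
  have e : ∀ x, f x * ((√(volume (W.E I α)).toReal)⁻¹ *
      ((W.E2 I α).indicator (fun _ => (1 : ℝ)) x - (W.E1 I α).indicator (fun _ => (1 : ℝ)) x)) =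
      (√(volume (W.E I α)).toReal)⁻¹ *
        ((W.E2 I α).indicator f x - (W.E1 I α).indicator f x) := by
    intro x
    by_cases h1 : x ∈ W.E1 I α <;> by_cases h2 : x ∈ W.E2 I α <;> simp [h1, h2] <;> ring
  simp_rw [e]
  rw [integral_const_mul, integral_sub, integral_indicator (W.E2_meas I α),
    integral_indicator (W.E1_meas I α)]
  · exact (hf.mono_set (W.E2_sub I α)).integrable_indicator (W.E2_meas I α)
  · exact (hf.mono_set (W.E1_sub I α)).integrable_indicator (W.E1_meas I α)

lemma sum_dev {κ : Type} [Fintype κ] [DecidableEq κ] (u : κ → ℝ) (m : ℝ) (B1 B2 : Finset κ)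
    (hB : B1.card = B2.card) :
    (∑ b ∈ B2, u b - ∑ b ∈ B1, u b) ^ 2 ≤ 4 * (Fintype.card κ * ∑ b, (u b - m) ^ 2) := by
  have e : ∑ b ∈ B2, u b - ∑ b ∈ B1, u b = ∑ b ∈ B2, (u b - m) - ∑ b ∈ B1, (u b - m) := by
    simp [Finset.sum_sub_distrib, hB]
  have h : ∀ B : Finset κ, |∑ b ∈ B, (u b - m)| ≤ ∑ b, |u b - m| := fun B =>
    (Finset.abs_sum_le_sum_abs _ _).trans
      (Finset.sum_le_sum_of_subset_of_nonneg (Finset.subset_univ _) fun _ _ _ => abs_nonneg _)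
  have h1 := abs_le.1 (h B1)
  have h2 := abs_le.1 (h B2)
  have h3 : (∑ b, |u b - m|) ^ 2 ≤ Fintype.card κ * ∑ b, (u b - m) ^ 2 := by
    have := sq_sum_le_card_mul_sum_sq (s := Finset.univ) (f := fun b => |u b - m|)
    simpa using this
  rw [e]
  calc _ ≤ (2 * ∑ b, |u b - m|) ^ 2 := sq_le_sq' (by linarith) (by linarith)
    _ = 4 * (∑ b, |u b - m|) ^ 2 := by ring
    _ ≤ _ := by gcongr

/-- The local variance. -/
def Del (f : (Fin d → ℝ) → ℝ) (Q : DyadicCube d) : ℝ :=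
  ∑ b, (∫ x in (Q.child b).toSet, f x) ^ 2 / (Q.child b).vol - (∫ x in Q.toSet, f x) ^ 2 / Q.vol

lemma Del_eq {f : (Fin d → ℝ) → ℝ} (Q : DyadicCube d) (hf : IntegrableOn f Q.toSet) :
    Del f Q = (∑ b, ((∫ x in (Q.child b).toSet, f x) - (∫ x in Q.toSet, f x) / 2 ^ d) ^ 2) /
      (Q.vol / 2 ^ d) := by
  have hv : ∀ b, (Q.child b).vol = Q.vol / 2 ^ d := by
    intro b; rw [Q.vol_child b]; field_simp
  have hp := Q.vol_pos
  have hadd := Q.setIntegral_additive hf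
  unfold Del
  simp only [hv]
  set u : (Fin d → Bool) → ℝ := fun b => ∫ x in (Q.child b).toSet, f x
  set U := ∫ x in Q.toSet, f x
  have : ∑ b, (u b - U / 2 ^ d) ^ 2 = ∑ b, u b ^ 2 - U ^ 2 / 2 ^ d := by
    have : ∀ b, (u b - U / 2 ^ d) ^ 2 = u b ^ 2 - 2 * (U / 2 ^ d) * u b + (U / 2 ^ d) ^ 2 := by
      intro b; ring
    simp only [this, Finset.sum_add_distrib, Finset.sum_sub_distrib, ← Finset.mul_sum]
    rw [show ∑ b, u b = U from hadd.symm]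
    simp
    field_simp
    ring
  rw [this, ← Finset.sum_div]
  field_simp
  try ring

lemma Del_nonneg {f : (Fin d → ℝ) → ℝ} (Q : DyadicCube d) (hf : IntegrableOn f Q.toSet) :
    0 ≤ Del f Q := by
  rw [Del_eq Q hf]
  have := Q.vol_pos
  positivity

lemma hcoef_sq_le {f : (Fin d → ℝ) → ℝ} (I α) (hf : IntegrableOn f I.toSet) :
    W.hcoef f I α ^ 2 ≤ 4 * 2 ^ d * Del f I := by
  rw [W.hcoef_eq I α hf, Del_eq I hf]
  have hEp := W.volE_pos I α
  have hEg := W.volE_ge I α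
  obtain ⟨B1, hB1, h1⟩ := union_children (W.childUnion1 I α)
  obtain ⟨B2, hB2, h2⟩ := union_children (W.childUnion2 I α)
  have hp := I.vol_pos
  have hcard : B1.card = B2.card := by
    have := congrArg ENNReal.toReal (W.measEq I α)
    rw [h1, h2, union_volume, union_volume] at this
    have h3 := mul_right_cancel₀ (by positivity) this
    exact_mod_cast h3
  rw [h1, h2, union_integral B1 hf, union_integral B2 hf, mul_pow, inv_pow, Real.sq_sqrt hEp.le]
  have key := sum_dev (fun b => ∫ x in (I.child b).toSet, f x) ((∫ x in I.toSet, f x) / 2 ^ d)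
    B1 B2 hcard
  have hc : (Fintype.card (Fin d → Bool) : ℝ) = 2 ^ d := by simp
  rw [hc] at key
  have hv : 0 < I.vol / 2 ^ d := by positivity
  calc _ ≤ (I.vol / 2 ^ d)⁻¹ * (4 * (2 ^ d * ∑ b, ((∫ x in (I.child b).toSet, f x) -
        (∫ x in I.toSet, f x) / 2 ^ d) ^ 2)) := by gcongr
    _ = _ := by ring

lemma cs_integral {S : Set (Fin d → ℝ)} {p q r : (Fin d → ℝ) → ℝ}
    (hp : IntegrableOn p S) (hq : IntegrableOn q S) (hr : IntegrableOn r S)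
    (hp0 : ∀ x, 0 ≤ p x) (hq0 : ∀ x, 0 ≤ q x) (hr0 : ∀ x, 0 ≤ r x)
    (h : ∀ x, p x ^ 2 ≤ q x * r x) :
    (∫ x in S, p x) ^ 2 ≤ (∫ x in S, q x) * ∫ x in S, r x := by
  have key : ∀ t : ℝ, 0 ≤ (∫ x in S, q x) * (t * t) + (-2 * ∫ x in S, p x) * t + ∫ x in S, r x := by
    intro t
    have : (∫ x in S, q x) * (t * t) + (-2 * ∫ x in S, p x) * t + ∫ x in S, r x =
        ∫ x in S, ((t * t) * q x + (-2 * t) * p x + r x) := by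
      have hqp : IntegrableOn (fun x => t * t * q x + -2 * t * p x) S :=
        (hq.const_mul _).add (hp.const_mul _)
      rw [integral_add hqp hr,
        integral_add (hq.const_mul _) (hp.const_mul _), integral_const_mul, integral_const_mul]
      ring
    rw [this]
    apply integral_nonneg
    intro x
    have h1 := HaarCore.amgm' (hq0 x) (hr0 x) (hp0 x) (h x) t
    simpa using h1
  have := discrim_le_zero key
  unfold discrim at this
  nlinarith

end WilsonSystem
namespace WilsonSystem
variable {d : ℕ} (W : WilsonSystem d)

/-- The constant in the bilinear estimate. -/
def C1 (d : ℕ) : ℝ :=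
  4 * (16 * (2 ^ d) ^ 2 * ((Fintype.card (Gamma d) + 1) * (4 * 2 ^ d)))

lemma C1_pos (d : ℕ) : 0 < C1 d := by unfold C1; positivity

lemma integrable_of_sq {f w : (Fin d → ℝ) → ℝ} (hw0 : ∀ x, 0 < w x)
    (hf : AEStronglyMeasurable f volume) (hwi : LocallyIntegrable (fun x => (w x)⁻¹) volume)
    (hX : Integrable (fun x => f x ^ 2 * w x) volume) (Q : DyadicCube d) :
    IntegrableOn f Q.toSet := by
  have h1 := Q.integrableOn_of_loc hwi
  refine Integrable.mono' (hX.integrableOn.add h1) hf.restrict (Filter.Eventually.of_forall ?_)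
  intro x
  have := hw0 x
  simp only [Pi.add_apply, Real.norm_eq_abs]
  have h2 : 0 ≤ (w x)⁻¹ := by positivity
  have h3 : |f x| ^ 2 = f x ^ 2 := sq_abs _
  have h4 : w x * (w x)⁻¹ = 1 := mul_inv_cancel₀ this.ne'
  have h5 := HaarCore.amgm (x := 1) (y := 1) (v := |f x|) (S := f x ^ 2 * w x) (W := (w x)⁻¹)
    (by norm_num) (by norm_num) (by positivity) h2 (by rw [h3, mul_assoc, h4, mul_one])
  have := abs_nonneg (f x)
  linarith

lemma sum_setIntegral_le {F : (Fin d → ℝ) → ℝ} (hF : Integrable F volume) (h0 : ∀ x, 0 ≤ F x)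
    (S : Finset (DyadicCube d)) (hS : ∀ I ∈ S, ∀ J ∈ S, I ≠ J → Disjoint I.toSet J.toSet) :
    ∑ Q ∈ S, ∫ x in Q.toSet, F x ≤ ∫ x, F x := by
  rw [← integral_biUnion_finset S (fun Q _ => Q.measurableSet_toSet)
    (fun I hI J hJ h => hS I hI J hJ h) (fun Q _ => hF.integrableOn)]
  exact setIntegral_le_integral hF (Filter.Eventually.of_forall h0)

lemma setIntegral_pos' {w : (Fin d → ℝ) → ℝ} (hw0 : ∀ x, 0 < w x) (Q : DyadicCube d)
    (hw : IntegrableOn w Q.toSet) : 0 < ∫ x in Q.toSet, w x := by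
  rw [setIntegral_pos_iff_support_of_nonneg_ae
    (Filter.Eventually.of_forall fun x => (hw0 x).le) hw]
  have : Function.support w = Set.univ := by
    ext x; simp [(hw0 x).ne']
  rw [this, Set.univ_inter, Q.volume_toSet]
  simpa using Q.vol_pos

lemma weight_cs {w : (Fin d → ℝ) → ℝ} (hw : IsWeight w) (Q : DyadicCube d) :
    Q.vol ^ 2 ≤ (∫ x in Q.toSet, (w x)⁻¹) * ∫ x in Q.toSet, w x := by
  have h := cs_integral (S := Q.toSet) (p := fun _ => 1) (q := fun x => (w x)⁻¹) (r := w)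
    (integrableOn_const (by rw [Q.volume_toSet]; exact ENNReal.ofReal_ne_top))
    (Q.integrableOn_of_loc hw.2.2.2) (Q.integrableOn_of_loc hw.2.2.1)
    (fun _ => zero_le_one) (fun x => (inv_pos.2 (hw.1 x)).le) (fun x => (hw.1 x).le)
    (fun x => by rw [inv_mul_cancel₀ (hw.1 x).ne']; norm_num)
  simpa [Measure.real, Q.volume_toReal] using h

lemma weight_A2 {w : (Fin d → ℝ) → ℝ} {A : ℝ} (hA : IsA2Bound w A) (Q : DyadicCube d) :
    (∫ x in Q.toSet, (w x)⁻¹) * (∫ x in Q.toSet, w x) ≤ A * Q.vol ^ 2 := by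
  have h := hA (fun i => (Q.m i : ℝ) * (2 : ℝ) ^ Q.k) ((2 : ℝ) ^ Q.k) (by positivity)
  rw [← Q.toSet_eq_cube] at h
  unfold avg at h
  rw [Q.volume_toReal, div_mul_div_comm, div_le_iff₀ (mul_pos Q.vol_pos Q.vol_pos)] at h
  linarith

lemma one_le_A {w : (Fin d → ℝ) → ℝ} {A : ℝ} (hw : IsWeight w) (hA : IsA2Bound w A) : 1 ≤ A := by
  have h := (weight_cs hw (⟨0, 0⟩ : DyadicCube d)).trans (weight_A2 hA _)
  have := (⟨0, 0⟩ : DyadicCube d).vol_pos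
  by_contra hlt
  push Not at hlt
  nlinarith [sq_pos_of_pos this]

lemma hcoef_abs_mul_le {f g : (Fin d → ℝ) → ℝ} (I α) (hf : IntegrableOn f I.toSet)
    (hg : IntegrableOn g I.toSet) :
    |W.hcoef f I α| * |W.hcoef g I α| ≤ (4 * 2 ^ d) * (√(Del f I) * √(Del g I)) := by
  have h1 : ∀ {f : (Fin d → ℝ) → ℝ}, IntegrableOn f I.toSet →
      |W.hcoef f I α| ≤ √(4 * 2 ^ d) * √(Del f I) := by
    intro f hf
    rw [← Real.sqrt_mul (by positivity)]
    exact Real.abs_le_sqrt (W.hcoef_sq_le I α hf)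
  calc _ ≤ (√(4 * 2 ^ d) * √(Del f I)) * (√(4 * 2 ^ d) * √(Del g I)) :=
        mul_le_mul (h1 hf) (h1 hg) (abs_nonneg _) (by positivity)
    _ = (√(4 * 2 ^ d) * √(4 * 2 ^ d)) * (√(Del f I) * √(Del g I)) := by ring
    _ = _ := by rw [Real.mul_self_sqrt (by positivity)]

theorem bilinear {w : (Fin d → ℝ) → ℝ} {A : ℝ} (hw : IsWeight w) (hA : IsA2Bound w A)
    {f g : (Fin d → ℝ) → ℝ} (hf : AEStronglyMeasurable f volume)
    (hg : AEStronglyMeasurable g volume) (hX : Integrable (fun x => f x ^ 2 * w x) volume)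
    (hY : Integrable (fun x => g x ^ 2 * (w x)⁻¹) volume) (F : Finset (DyadicCube d × Gamma d)) :
    ∑ p ∈ F, |W.hcoef f p.1 p.2| * |W.hcoef g p.1 p.2| ≤
      C1 d * A * ((∫ x, f x ^ 2 * w x) + ∫ x, g x ^ 2 * (w x)⁻¹) := by
  classical
  have hA1 := one_le_A hw hA
  obtain ⟨hw0, hwm, hwl, hwi⟩ := id hw
  have hwi0 : ∀ x, 0 < (w x)⁻¹ := fun x => inv_pos.2 (hw0 x)
  have hfi := integrable_of_sq hw0 hf hwi hX
  have hgi := integrable_of_sq (w := fun x => (w x)⁻¹) hwi0 hg (by simpa using hwl) hY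
  have hX0 : ∀ x, 0 ≤ f x ^ 2 * w x := fun x => mul_nonneg (sq_nonneg _) (hw0 x).le
  have hY0 : ∀ x, 0 ≤ g x ^ 2 * (w x)⁻¹ := fun x => mul_nonneg (sq_nonneg _) (hwi0 x).le
  let a : DyadicCube d → ℝ := fun I => ∑ α, |W.hcoef f I α| * |W.hcoef g I α|
  have ha0 : ∀ I, 0 ≤ a I := fun I => Finset.sum_nonneg fun α _ => by positivity
  obtain ⟨n, S, hS, hT⟩ := DyadicCube.exists_tops (F.image Prod.fst)
  have hM : (0 : ℝ) ≤ (Fintype.card (Gamma d) + 1) * (4 * 2 ^ d) := by positivity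
  have core := HaarCore.main (DyadicCube.child (d := d)) DyadicCube.vol
    (fun Q => ∫ x in Q.toSet, (w x)⁻¹) (fun Q => ∫ x in Q.toSet, w x)
    (fun Q => ∫ x in Q.toSet, f x ^ 2 * w x) (fun Q => ∫ x in Q.toSet, g x ^ 2 * (w x)⁻¹)
    (fun Q => ∫ x in Q.toSet, |f x|) (fun Q => ∫ x in Q.toSet, |g x|)
    (fun Q => ∫ x in Q.toSet, f x) (fun Q => ∫ x in Q.toSet, g x)
    (Del f) (Del g) a (2 ^ d) ((Fintype.card (Gamma d) + 1) * (4 * 2 ^ d)) A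
    (one_le_pow₀ (by norm_num)) hM (by linarith) (fun Q => Q.vol_pos)
    (fun Q => setIntegral_pos' hwi0 Q (Q.integrableOn_of_loc hwi))
    (fun Q => setIntegral_pos' hw0 Q (Q.integrableOn_of_loc hwl))
    (fun Q => integral_nonneg hX0) (fun Q => integral_nonneg hY0)
    (fun Q => integral_nonneg fun x => abs_nonneg _)
    (fun Q => integral_nonneg fun x => abs_nonneg _)
    (fun Q b => Q.vol_child b) (fun Q => Q.vol_additive)
    (fun Q => Q.setIntegral_additive (Q.integrableOn_of_loc hwi))
    (fun Q => Q.setIntegral_additive (Q.integrableOn_of_loc hwl))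
    (fun Q => Q.setIntegral_additive hX.integrableOn)
    (fun Q => Q.setIntegral_additive hY.integrableOn)
    (fun Q => Q.setIntegral_additive (hfi Q).abs)
    (fun Q => Q.setIntegral_additive (hgi Q).abs)
    (fun Q => abs_integral_le_integral_abs) (fun Q => abs_integral_le_integral_abs)
    (fun Q => cs_integral (hfi Q).abs hX.integrableOn (Q.integrableOn_of_loc hwi)
      (fun x => abs_nonneg _) hX0 (fun x => (hwi0 x).le)
      (fun x => by rw [sq_abs, mul_assoc, mul_inv_cancel₀ (hw0 x).ne', mul_one]))
    (fun Q => cs_integral (hgi Q).abs hY.integrableOn (Q.integrableOn_of_loc hwl)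
      (fun x => abs_nonneg _) hY0 (fun x => (hw0 x).le)
      (fun x => by rw [sq_abs, mul_assoc, inv_mul_cancel₀ (hw0 x).ne', mul_one]))
    (fun Q => weight_cs hw Q) (fun Q => weight_A2 hA Q)
    (fun Q => rfl) (fun Q => rfl) (fun Q => Del_nonneg Q (hfi Q)) (fun Q => Del_nonneg Q (hgi Q))
    (fun Q => by
      calc a Q ≤ ∑ _α : Gamma d, (4 * 2 ^ d) * (√(Del f Q) * √(Del g Q)) :=
            Finset.sum_le_sum fun α _ => W.hcoef_abs_mul_le Q α (hfi Q) (hgi Q)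
        _ = Fintype.card (Gamma d) * ((4 * 2 ^ d) * (√(Del f Q) * √(Del g Q))) := by simp
        _ ≤ (Fintype.card (Gamma d) + 1) * ((4 * 2 ^ d) * (√(Del f Q) * √(Del g Q))) := by
            gcongr; linarith
        _ = _ := by ring) n
  have hD : 0 ≤ 16 * (2 ^ d) ^ 2 * ((Fintype.card (Gamma d) + 1) * (4 * 2 ^ d)) * A := by
    positivity
  set D := 16 * (2 ^ d) ^ 2 * ((Fintype.card (Gamma d) + 1) * (4 * 2 ^ d)) * A with hDdef
  calc ∑ p ∈ F, |W.hcoef f p.1 p.2| * |W.hcoef g p.1 p.2|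
      ≤ ∑ p ∈ (F.image Prod.fst) ×ˢ Finset.univ, |W.hcoef f p.1 p.2| * |W.hcoef g p.1 p.2| := by
        apply Finset.sum_le_sum_of_subset_of_nonneg
        · intro p hp
          simp only [Finset.mem_product, Finset.mem_univ, and_true]
          exact Finset.mem_image_of_mem _ hp
        · intros; positivity
    _ = ∑ I ∈ F.image Prod.fst, a I := by rw [Finset.sum_product]
    _ ≤ ∑ Q ∈ S, HaarCore.T DyadicCube.child a n Q := hT a ha0
    _ ≤ ∑ Q ∈ S, D * (4 * (∫ x in Q.toSet, f x ^ 2 * w x) +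
          4 * ∫ x in Q.toSet, g x ^ 2 * (w x)⁻¹) := by
        apply Finset.sum_le_sum
        intro Q _
        refine (core Q).trans (mul_le_mul_of_nonneg_left ?_ hD)
        have h1 : 0 ≤ (∫ x in Q.toSet, |f x|) ^ 2 / ∫ x in Q.toSet, (w x)⁻¹ :=
          div_nonneg (sq_nonneg _) (integral_nonneg fun x => (hwi0 x).le)
        have h2 : 0 ≤ (∫ x in Q.toSet, |g x|) ^ 2 / ∫ x in Q.toSet, w x :=
          div_nonneg (sq_nonneg _) (integral_nonneg fun x => (hw0 x).le)
        linarith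
    _ = D * (4 * (∑ Q ∈ S, ∫ x in Q.toSet, f x ^ 2 * w x) +
          4 * ∑ Q ∈ S, ∫ x in Q.toSet, g x ^ 2 * (w x)⁻¹) := by
        rw [Finset.mul_sum, Finset.mul_sum, ← Finset.sum_add_distrib, Finset.mul_sum]
    _ ≤ D * (4 * (∫ x, f x ^ 2 * w x) + 4 * ∫ x, g x ^ 2 * (w x)⁻¹) := by
        have h1 := sum_setIntegral_le hX hX0 S hS
        have h2 := sum_setIntegral_le hY hY0 S hS
        gcongr
    _ = _ := by rw [hDdef, C1]; ring

end WilsonSystem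
namespace WilsonSystem
variable {d : ℕ} (W : WilsonSystem d)

lemma haar_meas (I α) : Measurable (W.haar I α) := by
  unfold haar
  exact measurable_const.mul ((measurable_const.indicator (W.E2_meas I α)).sub
    (measurable_const.indicator (W.E1_meas I α)))

lemma haar_bdd (I α) (x : Fin d → ℝ) :
    ‖W.haar I α x‖ ≤ (√(volume (W.E I α)).toReal)⁻¹ := by
  unfold haar
  have h0 : 0 ≤ (√(volume (W.E I α)).toReal)⁻¹ := by positivity
  rw [norm_mul, Real.norm_of_nonneg h0]
  refine mul_le_of_le_one_right h0 ?_
  by_cases h1 : x ∈ W.E1 I α <;> by_cases h2 : x ∈ W.E2 I α <;> simp [h1, h2]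

lemma haar_off (I α) {x : Fin d → ℝ} (hx : x ∉ W.E I α) : W.haar I α x = 0 := by
  have h1 : x ∉ W.E1 I α := fun h => hx (Or.inl h)
  have h2 : x ∉ W.E2 I α := fun h => hx (Or.inr h)
  simp [haar, h1, h2]

lemma haar_sq (I α) {x : Fin d → ℝ} (hx : x ∈ W.E I α) :
    W.haar I α x * W.haar I α x * (volume (W.E I α)).toReal = 1 := by
  have hp := W.volE_pos I α
  have hs := Real.mul_self_sqrt hp.le
  have hs0 : √(volume (W.E I α)).toReal ≠ 0 := (Real.sqrt_pos.2 hp).ne'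
  have key : (√(volume (W.E I α)).toReal)⁻¹ * (√(volume (W.E I α)).toReal)⁻¹ *
      (volume (W.E I α)).toReal = 1 := by
    nth_rewrite 3 [← hs]
    field_simp
  rcases hx with h1 | h2
  · have h2 : x ∉ W.E2 I α := Set.disjoint_left.1 (W.disj I α) h1
    simp only [haar, Set.indicator_of_mem h1, Set.indicator_of_notMem h2]
    linarith
  · have h1 : x ∉ W.E1 I α := Set.disjoint_right.1 (W.disj I α) h2
    simp only [haar, Set.indicator_of_mem h2, Set.indicator_of_notMem h1]
    linarith

lemma haar_mul_w {w : (Fin d → ℝ) → ℝ} (hw : LocallyIntegrable w volume) (I α) :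
    Integrable (fun x => W.haar I α x * w x) volume := by
  have h1 : Integrable (I.toSet.indicator w) volume :=
    (I.integrableOn_of_loc hw).integrable_indicator I.measurableSet_toSet
  have h2 := h1.bdd_mul (W.haar_meas I α).aestronglyMeasurable
    (Filter.Eventually.of_forall (W.haar_bdd I α))
  refine h2.congr (Filter.Eventually.of_forall fun x => ?_)
  by_cases hx : x ∈ I.toSet
  · simp [hx]
  · have : x ∉ W.E I α := fun h => hx (W.E_sub I α h)
    simp [hx, W.haar_off I α this]

/-- Partial sums of the multiplier. -/
def pS (σ : DyadicCube d → Gamma d → ℝ) (f : (Fin d → ℝ) → ℝ)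
    (F : Finset (DyadicCube d × Gamma d)) (x : Fin d → ℝ) : ℝ :=
  ∑ p ∈ F, σ p.1 p.2 * W.hcoef f p.1 p.2 * W.haar p.1 p.2 x

lemma pS_meas (σ f F) : Measurable (W.pS σ f F) := by
  unfold pS
  exact Finset.measurable_sum _ fun p _ => (W.haar_meas p.1 p.2).const_mul _

lemma finite_bound {w f : (Fin d → ℝ) → ℝ} {A N : ℝ} {σ : DyadicCube d → Gamma d → ℝ}
    (hw : IsWeight w) (hA : IsA2Bound w A) (hN : 0 < N) (hσ : ∀ I α, |σ I α| ≤ N)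
    (hf : AEStronglyMeasurable f volume)
    (hX : Integrable (fun x => f x ^ 2 * w x) volume) (F : Finset (DyadicCube d × Gamma d)) :
    Integrable (fun x => W.pS σ f F x ^ 2 * w x) volume ∧
    ∫ x, W.pS σ f F x ^ 2 * w x ≤ (2 * C1 d * A * N) ^ 2 * ∫ x, f x ^ 2 * w x := by
  have hA1 := one_le_A hw hA
  have hC := C1_pos d
  set B : ℝ := N * (C1 d * A) with hB
  have hB0 : 0 < B := by positivity
  set κ : ℝ := (2 * B)⁻¹ with hκ
  have hκB : κ * (2 * B) = 1 := inv_mul_cancel₀ (by positivity)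
  set u := W.pS σ f F with hu
  have hum : Measurable u := W.pS_meas σ f F
  have i1 : Integrable (fun x => u x * w x) volume := by
    have : (fun x => u x * w x) = fun x => ∑ p ∈ F,
        (σ p.1 p.2 * W.hcoef f p.1 p.2) * (W.haar p.1 p.2 x * w x) := by
      funext x
      simp only [hu, pS, Finset.sum_mul, mul_assoc]
    rw [this]
    exact integrable_finsetSum _ fun p _ => (W.haar_mul_w hw.2.2.1 p.1 p.2).const_mul _
  have i2 : ∀ p : DyadicCube d × Gamma d, Integrable (fun x => u x * w x * W.haar p.1 p.2 x) volume :=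
    fun p => i1.mul_bdd (W.haar_meas p.1 p.2).aestronglyMeasurable
      (Filter.Eventually.of_forall (W.haar_bdd p.1 p.2))
  have e2 : (fun x => u x ^ 2 * w x) = fun x => ∑ p ∈ F,
      (σ p.1 p.2 * W.hcoef f p.1 p.2) * (u x * w x * W.haar p.1 p.2 x) := by
    funext x
    have : u x ^ 2 * w x = u x * w x * u x := by ring
    rw [this]
    nth_rewrite 2 [hu]
    simp only [pS, Finset.mul_sum]
    refine Finset.sum_congr rfl fun p _ => by ring
  have i3 : Integrable (fun x => u x ^ 2 * w x) volume := by
    rw [e2]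
    exact integrable_finsetSum _ fun p _ => (i2 p).const_mul _
  refine ⟨i3, ?_⟩
  set g : (Fin d → ℝ) → ℝ := fun x => κ * (u x * w x) with hg
  have eg : (fun x => g x ^ 2 * (w x)⁻¹) = fun x => κ ^ 2 * (u x ^ 2 * w x) := by
    funext x
    have := (hw.1 x).ne'
    simp only [hg]; field_simp
  have hY : Integrable (fun x => g x ^ 2 * (w x)⁻¹) volume := by
    rw [eg]; exact i3.const_mul _
  have hbil := W.bilinear hw hA hf ((i1.const_mul κ).aestronglyMeasurable) hX hY F
  rw [eg, integral_const_mul] at hbil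
  have hc : ∀ p : DyadicCube d × Gamma d, W.hcoef g p.1 p.2 =
      κ * ∫ x, u x * w x * W.haar p.1 p.2 x := by
    intro p
    unfold hcoef
    rw [← integral_const_mul]
    simp only [hg, mul_assoc]
  set Z := ∫ x, u x ^ 2 * w x with hZ
  set X := ∫ x, f x ^ 2 * w x with hXd
  have hZe : κ * Z = ∑ p ∈ F, σ p.1 p.2 * W.hcoef f p.1 p.2 * W.hcoef g p.1 p.2 := by
    rw [hZ, e2, integral_finsetSum _ fun p _ => (i2 p).const_mul _, Finset.mul_sum]
    refine Finset.sum_congr rfl fun p _ => ?_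
    rw [integral_const_mul, hc p]; ring
  have h1 : κ * Z ≤ N * ∑ p ∈ F, |W.hcoef f p.1 p.2| * |W.hcoef g p.1 p.2| := by
    rw [hZe, Finset.mul_sum]
    refine Finset.sum_le_sum fun p _ => (le_abs_self _).trans ?_
    rw [abs_mul, abs_mul, mul_assoc]
    exact mul_le_mul_of_nonneg_right (hσ _ _) (by positivity)
  have h2 : κ * Z ≤ B * (X + κ ^ 2 * Z) := by
    refine h1.trans ((mul_le_mul_of_nonneg_left hbil hN.le).trans (le_of_eq ?_))
    rw [hB]; ring
  have h3 : Z ≤ 2 * B * B * X + 2 * B * B * κ ^ 2 * Z := by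
    have := mul_le_mul_of_nonneg_left h2 (by positivity : (0:ℝ) ≤ 2 * B)
    have e1 : 2 * B * (κ * Z) = Z := by linear_combination Z * hκB
    rw [e1] at this
    linarith
  have h4 : 2 * B * B * κ ^ 2 = 1 / 2 := by
    linear_combination (1 / 2 : ℝ) * (κ * (2 * B) + 1) * hκB
  rw [h4] at h3
  have h5 : (2 * C1 d * A * N) ^ 2 * X = 2 * (2 * B * B * X) := by rw [hB]; ring
  rw [h5]; linarith

lemma memLp_iff {w f : (Fin d → ℝ) → ℝ} (hw : IsWeight w) (hf : AEStronglyMeasurable f volume) :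
    MemLp f 2 (wMeasure w) ↔ Integrable (fun x => f x ^ 2 * w x) volume := by
  unfold wMeasure
  rw [memLp_two_iff_integrable_sq (hf.mono_ac (withDensity_absolutelyContinuous _ _)),
    integrable_withDensity_iff hw.2.1.ennreal_ofReal
      (Filter.Eventually.of_forall fun _ => ENNReal.ofReal_lt_top)]
  simp only [fun x => ENNReal.toReal_ofReal (hw.1 x).le]

lemma eLpNorm_eq {w f : (Fin d → ℝ) → ℝ} (hw : IsWeight w) (hf : MemLp f 2 (wMeasure w)) :
    eLpNorm f 2 (wMeasure w) = ENNReal.ofReal (√(∫ x, f x ^ 2 * w x)) := by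
  rw [hf.eLpNorm_eq_integral_rpow_norm (by norm_num) (by norm_num), Real.sqrt_eq_rpow]
  unfold wMeasure
  rw [integral_withDensity_eq_integral_toReal_smul hw.2.1.ennreal_ofReal
      (Filter.Eventually.of_forall fun _ => ENNReal.ofReal_lt_top)]
  simp [fun x => ENNReal.toReal_ofReal (hw.1 x).le, mul_comm]

lemma finite_eLp {w f : (Fin d → ℝ) → ℝ} {A N : ℝ} {σ : DyadicCube d → Gamma d → ℝ}
    (hw : IsWeight w) (hA : IsA2Bound w A) (hN : 0 < N) (hσ : ∀ I α, |σ I α| ≤ N)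
    (hfin : eLpNorm f 2 (wMeasure w) ≠ ⊤) (F : Finset (DyadicCube d × Gamma d)) :
    eLpNorm (W.pS σ f F) 2 (wMeasure w) ≤
      ENNReal.ofReal (2 * C1 d * A * N) * eLpNorm f 2 (wMeasure w) := by
  classical
  set F' := F.filter fun p => W.hcoef f p.1 p.2 ≠ 0 with hF'
  set U : Set (Fin d → ℝ) := ⋃ p : F', W.E p.1.1 p.1.2 with hU
  have hUm : MeasurableSet U := MeasurableSet.iUnion fun p => W.E_meas _ _
  set f' := U.indicator f with hf'
  have hm : AEStronglyMeasurable f' volume := by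
    rw [hf', aestronglyMeasurable_indicator_iff hUm, hU, aestronglyMeasurable_iUnion_iff]
    rintro ⟨⟨I, α⟩, hp⟩
    simp only
    rw [← aestronglyMeasurable_indicator_iff (W.E_meas I α)]
    have hi : Integrable (fun x => f x * W.haar I α x) volume := by
      by_contra h
      exact (Finset.mem_filter.1 hp).2 (integral_undef h)
    have := hi.aestronglyMeasurable.mul
      ((W.haar_meas I α).mul_const (volume (W.E I α)).toReal).aestronglyMeasurable
    refine this.congr (Filter.Eventually.of_forall fun x => ?_)
    by_cases hx : x ∈ W.E I α
    · have := W.haar_sq I α hx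
      simp only [Pi.mul_apply, Set.indicator_of_mem hx]
      linear_combination f x * this
    · simp [hx, W.haar_off I α hx]
  have hle : eLpNorm f' 2 (wMeasure w) ≤ eLpNorm f 2 (wMeasure w) := eLpNorm_indicator_le f
  have hml : MemLp f' 2 (wMeasure w) :=
    ⟨hm.mono_ac (withDensity_absolutelyContinuous _ _), hle.trans_lt hfin.lt_top⟩
  have hcf : ∀ p ∈ F', W.hcoef f' p.1 p.2 = W.hcoef f p.1 p.2 := by
    intro p hp
    unfold hcoef
    congr 1
    funext x
    by_cases hx : x ∈ W.E p.1 p.2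
    · have : x ∈ U := Set.mem_iUnion.2 ⟨⟨p, hp⟩, hx⟩
      simp [hf', this]
    · simp [W.haar_off _ _ hx]
  have hS : W.pS σ f F = W.pS σ f' F' := by
    funext x
    unfold pS
    have e1 : ∑ p ∈ F', σ p.1 p.2 * W.hcoef f' p.1 p.2 * W.haar p.1 p.2 x =
        ∑ p ∈ F', σ p.1 p.2 * W.hcoef f p.1 p.2 * W.haar p.1 p.2 x :=
      Finset.sum_congr rfl fun p hp => by rw [hcf p hp]
    rw [e1, hF']
    symm
    apply Finset.sum_filter_of_ne
    intro p _ h h0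
    exact h (by rw [h0]; ring)
  obtain ⟨b1, b2⟩ := W.finite_bound hw hA hN hσ hm ((memLp_iff hw hm).1 hml) F'
  rw [hS]
  refine le_trans ?_ (mul_le_mul_right hle _)
  have hA1 := one_le_A hw hA
  have hC := C1_pos d
  have hK : 0 ≤ 2 * C1 d * A * N := by positivity
  rw [eLpNorm_eq hw ((memLp_iff hw (W.pS_meas σ f' F').aestronglyMeasurable).2 b1),
    eLpNorm_eq hw hml, ← ENNReal.ofReal_mul hK]
  apply ENNReal.ofReal_le_ofReal
  refine (Real.sqrt_le_sqrt b2).trans (le_of_eq ?_)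
  rw [Real.sqrt_mul (by positivity), Real.sqrt_sq hK]

lemma Tmult_bound {w f : (Fin d → ℝ) → ℝ} {K : ENNReal} {σ : DyadicCube d → Gamma d → ℝ}
    (h : ∀ F, eLpNorm (W.pS σ f F) 2 (wMeasure w) ≤ K) :
    eLpNorm (W.Tmult σ f) 2 (wMeasure w) ≤ K := by
  set t : (DyadicCube d × Gamma d) → (Fin d → ℝ) → ℝ :=
    fun p x => σ p.1 p.2 * W.hcoef f p.1 p.2 * W.haar p.1 p.2 x with ht
  have htm : ∀ p, Measurable (t p) := fun p => (W.haar_meas p.1 p.2).const_mul _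
  set G : Set (Fin d → ℝ) := {x | ∑' p, ‖t p x‖ₑ < ⊤} with hG
  have hGm : MeasurableSet G :=
    measurableSet_lt (Measurable.ennreal_tsum fun p => (htm p).enorm) measurable_const
  have hGs : ∀ x, x ∈ G ↔ Summable fun p => t p x := by
    intro x
    rw [← summable_norm_iff, hG, Set.mem_setOf_eq, lt_top_iff_ne_top]
    simp only [enorm]
    rw [ENNReal.tsum_coe_ne_top_iff_summable, ← NNReal.summable_coe]
    simp
  refine Lp.eLpNorm_le_of_ae_tendsto (u := Filter.atTop)
    (f := fun F : Finset (DyadicCube d × Gamma d) => G.indicator (W.pS σ f F)) ?_ ?_ ?_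
  · exact Filter.Eventually.of_forall fun F => (eLpNorm_indicator_le _).trans (h F)
  · intro F
    exact ((W.pS_meas σ f F).indicator hGm).aestronglyMeasurable
  · refine Filter.Eventually.of_forall fun x => ?_
    by_cases hx : x ∈ G
    · simp only [Set.indicator_of_mem hx]
      exact ((hGs x).1 hx).hasSum
    · simp only [Set.indicator_of_notMem hx]
      have : W.Tmult σ f x = 0 := tsum_eq_zero_of_not_summable fun hs => hx ((hGs x).2 hs)
      rw [this]
      exact tendsto_const_nhds

end WilsonSystem

/-- The Haar multiplier `T_σ` is bounded on `L²(w)` with norm at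
most `C_d · [w]_{A₂} · ‖σ‖_∞`. -/
theorem haar_multiplier_linear_bound (d : ℕ) :
    ∃ C : ℝ, 0 < C ∧
      ∀ (W : WilsonSystem d) (w : (Fin d → ℝ) → ℝ) (A : ℝ)
        (σ : DyadicCube d → Gamma d → ℝ) (N : ℝ),
        IsWeight w → IsA2Bound w A → (∀ I α, |σ I α| ≤ N) →
        ∀ f : (Fin d → ℝ) → ℝ,
          eLpNorm (W.Tmult σ f) 2 (wMeasure w) ≤
            ENNReal.ofReal (C * A * N) * eLpNorm f 2 (wMeasure w) := by
  refine ⟨2 * WilsonSystem.C1 d, by have := WilsonSystem.C1_pos d; positivity, ?_⟩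
  intro W w A σ N hw hA hσ f
  rcases le_or_gt N 0 with hN | hN
  · have h0 : W.Tmult σ f = 0 := by
      funext x
      have : ∀ I α, σ I α = 0 := fun I α =>
        abs_eq_zero.1 (le_antisymm ((hσ I α).trans hN) (abs_nonneg _))
      simp [WilsonSystem.Tmult, this]
    rw [h0]; simp
  · by_cases hfin : eLpNorm f 2 (wMeasure w) = ⊤
    · have hA1 := WilsonSystem.one_le_A hw hA
      have hC := WilsonSystem.C1_pos d
      have : ENNReal.ofReal (2 * WilsonSystem.C1 d * A * N) ≠ 0 := by
        rw [Ne, ENNReal.ofReal_eq_zero, not_le]; positivity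
      rw [hfin, ENNReal.mul_top this]
      exact le_top
    · exact W.Tmult_bound fun F => W.finite_eLp hw hA hN hσ hfin F
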